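/- Let 1 < q < p ≤ ∞, let j ≥ 0 be an integer, and let α ∈ ℝ satisfy either −2/p < α < 1/q − 1/p, or p = ∞ and α = 0. Let Ψ(x) := (4π)^{−3/2} exp(−|x|²/4) be the heat kernel on ℝ³ at time 1. Then there exists C = C(p,q,j,α) such that for every axisymmetric Schwartz function f : ℝ³ → ℝ (meaning f(Rx) = f(x) for every rotation R ∈ SO(3) fixing the x₃-axis) one has ‖r^α · ∇^j(Ψ * f)‖_{L^p(ℝ³)} ≤ C·‖f‖_{L^{q,∞}}. -/

import Mathlib

noncomputable section
open Real MeasureTheory Filter Metric Set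
open scoped ENNReal NNReal Topology FourierTransform

/-- Three-dimensional Euclidean space. -/
abbrev E3 : Type := EuclideanSpace ℝ (Fin 3)

/-- The `i`-th partial derivative of a scalar function on `ℝ³`. -/
def pd (f : E3 → ℝ) (i : Fin 3) (x : E3) : ℝ :=
  fderiv ℝ f x (EuclideanSpace.single i 1)

/-- The Laplacian of a scalar function on `ℝ³`. -/
def lap (f : E3 → ℝ) (x : E3) : ℝ :=
  ∑ i : Fin 3, pd (fun y => pd f i y) i x

/-- `(u, pr)` is a classical solution of the Navier–Stokes equations on the time interval `I`. -/
def IsNSSol (u : ℝ → E3 → E3) (pr : ℝ → E3 → ℝ) (I : Set ℝ) : Prop :=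
  (ContDiff ℝ (⊤:ℕ∞) fun q : ℝ × E3 => u q.1 q.2) ∧
  (ContDiff ℝ (⊤:ℕ∞) fun q : ℝ × E3 => pr q.1 q.2) ∧
  (∀ t ∈ I, ∀ x : E3, ∀ i : Fin 3,
    deriv (fun s => u s x i) t - lap (fun y => u t y i) x
      + (∑ j : Fin 3, u t x j * pd (fun y => u t y i) j x) + pd (pr t) i x = 0) ∧
  (∀ t ∈ I, ∀ x : E3, (∑ i : Fin 3, pd (fun y => u t y i) i x) = 0)

/-- Rotation by angle `θ` about the `x₃`-axis. -/
def rotZ (θ : ℝ) (x : E3) : E3 :=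
  (WithLp.equiv 2 (Fin 3 → ℝ)).symm
    ![x 0 * Real.cos θ - x 1 * Real.sin θ, x 0 * Real.sin θ + x 1 * Real.cos θ, x 2]

/-- A time-dependent vector field is axisymmetric. -/
def AxiSym (u : ℝ → E3 → E3) : Prop := ∀ θ t x, u t (rotZ θ x) = rotZ θ (u t x)

/-- The weak `L^q` (quasi)norm `sup_{λ>0} λ · vol{|f| ≥ λ}^{1/q}`. -/
def wnorm' {F : Type*} [NormedAddCommGroup F] (f : E3 → F) (q : ℝ) : ℝ≥0∞ :=
  ⨆ (l : ℝ) (_ : 0 < l), ENNReal.ofReal l * (volume {x : E3 | l ≤ ‖f x‖}) ^ (1 / q)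

/-- The weak `L^3` norm. -/
def wnorm3 (f : E3 → E3) : ℝ≥0∞ := wnorm' f 3

/-- Distance to the `x₃`-axis. -/
def rr (x : E3) : ℝ := Real.sqrt (x 0 ^ 2 + x 1 ^ 2)

theorem one_add_pow_mul_exp_neg_sq_le (m : ℕ) {t : ℝ} (ht : 0 ≤ t) :
    (1 + t) ^ m * Real.exp (-t ^ 2 / 4) ≤ m.factorial * Real.exp 2 := by
  have h1 : (1 + t) ^ m ≤ m.factorial * Real.exp (1 + t) := by
    have := Real.pow_div_factorial_le_exp (1 + t) (by positivity) m
    rwa [div_le_iff₀ (by positivity), mul_comm] at this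
  calc (1 + t) ^ m * Real.exp (-t ^ 2 / 4)
      ≤ (m.factorial * Real.exp (1 + t)) * Real.exp (-t ^ 2 / 4) := by gcongr
    _ = m.factorial * Real.exp ((1 + t) + (-t ^ 2 / 4)) := by rw [Real.exp_add _ (-t ^ 2 / 4)]; ring
    _ ≤ m.factorial * Real.exp 2 := by
        gcongr
        nlinarith [sq_nonneg (t - 2)]

/-- The heat kernel on `ℝ³` at time `1`. -/
def heatK (z : E3) : ℝ := (4 * π) ^ (-(3:ℝ)/2) * Real.exp (-‖z‖^2 / 4)

theorem contDiff_heatK : ContDiff ℝ (⊤:ℕ∞) heatK := by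
  unfold heatK
  have : ContDiff ℝ (⊤:ℕ∞) fun z : E3 => ‖z‖ ^ 2 := contDiff_norm_sq ℝ
  fun_prop

/-- Every derivative of the heat kernel decays at least like `(1 + ‖z‖) ^ (-4)`. -/
theorem norm_iteratedFDeriv_heatK_le (j : ℕ) :
    ∃ C : ℝ, 0 < C ∧ ∀ z : E3, ‖iteratedFDeriv ℝ j heatK z‖ ≤ C * (1 + ‖z‖) ^ (-4 : ℝ) := by
  have htg : (fun z : E3 => -‖z‖ ^ 2 / 4).HasTemperateGrowth := by
    have h := Function.HasTemperateGrowth.mul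
      (Function.HasTemperateGrowth.const (E := E3) (-1/4 : ℝ))
      (Function.hasTemperateGrowth_norm_sq E3)
    have he : (fun z : E3 => -‖z‖ ^ 2 / 4) = (fun _ => (-1/4 : ℝ)) * fun z => ‖z‖ ^ 2 := by
      funext z
      simp only [Pi.mul_apply]
      ring
    rw [he]
    exact h
  obtain ⟨k, B, hB, hbd⟩ := htg.norm_iteratedFDeriv_le_uniform j
  refine ⟨(4 * π) ^ (-(3:ℝ)/2) *
    (j.factorial * ((B + 1) ^ j * ((k * j + 4).factorial * Real.exp 2))),
    by positivity, fun z => ?_⟩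
  have hz : 0 ≤ ‖z‖ := norm_nonneg z
  have hcomp : heatK = fun z => ((4 * π) ^ (-(3:ℝ)/2) : ℝ) •
      (Real.exp ∘ fun z : E3 => -‖z‖ ^ 2 / 4) z := by
    ext z; simp [heatK]
  have hsm : ContDiff ℝ (⊤:ℕ∞) (Real.exp ∘ fun z : E3 => -‖z‖ ^ 2 / 4) :=
    Real.contDiff_exp.comp htg.1
  rw [hcomp, iteratedFDeriv_const_smul_apply' (hsm.of_le (by exact_mod_cast le_top)).contDiffAt,
    norm_smul, Real.norm_of_nonneg (by positivity), mul_assoc]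
  refine mul_le_mul_of_nonneg_left ?_ (by positivity)
  have h1 := norm_iteratedFDeriv_comp_le (𝕜 := ℝ) (n := j) (N := ((⊤:ℕ∞) : WithTop ℕ∞))
    (g := Real.exp) (f := fun z : E3 => -‖z‖ ^ 2 / 4) Real.contDiff_exp htg.1
    (by exact_mod_cast le_top) z (C := Real.exp (-‖z‖ ^ 2 / 4)) (D := (B + 1) * (1 + ‖z‖) ^ k)
    (fun i _ => by
      rw [norm_iteratedFDeriv_eq_norm_iteratedDeriv, iteratedDeriv_eq_iterate, Real.iter_deriv_exp,
        Real.norm_of_nonneg (Real.exp_pos _).le])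
    (fun i hi hij => by
      refine (hbd i hij z).trans ?_
      have h0 : (1:ℝ) ≤ (1 + ‖z‖) ^ k := one_le_pow₀ (by linarith)
      have h2 : (1:ℝ) ≤ (B + 1) * (1 + ‖z‖) ^ k := by nlinarith
      calc B * (1 + ‖z‖) ^ k ≤ (B + 1) * (1 + ‖z‖) ^ k := by gcongr; linarith
        _ ≤ _ := le_self_pow₀ h2 (by omega))
  refine h1.trans ?_
  rw [mul_assoc, mul_assoc]
  refine mul_le_mul_of_nonneg_left ?_ (by positivity)
  rw [Real.rpow_neg (by positivity), ← div_eq_mul_inv, le_div_iff₀ (by positivity)]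
  have h4 : (1 + ‖z‖) ^ (4:ℝ) = (1 + ‖z‖) ^ (4:ℕ) := by
    rw [← Real.rpow_natCast]; norm_num
  rw [h4]
  have h5 := one_add_pow_mul_exp_neg_sq_le (k * j + 4) hz
  calc Real.exp (-‖z‖ ^ 2 / 4) * ((B + 1) * (1 + ‖z‖) ^ k) ^ j * (1 + ‖z‖) ^ 4
      = (B + 1) ^ j * ((1 + ‖z‖) ^ (k * j + 4) * Real.exp (-‖z‖ ^ 2 / 4)) := by
        rw [mul_pow, ← pow_mul, pow_add]; ring
    _ ≤ _ := by gcongr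

theorem aestronglyMeasurable_smul_continuous {F : Type*} [NormedAddCommGroup F] [NormedSpace ℝ F]
    {f : E3 → ℝ} {g : E3 → F} (hf : AEStronglyMeasurable f volume) (hg : Continuous g) :
    AEStronglyMeasurable (fun y => f y • g y) volume :=
  hf.smul hg.aestronglyMeasurable

/-- Derivatives of `heatK * f` fall on the kernel. -/
theorem iteratedFDeriv_convolution_heatK (f : E3 → ℝ) (hf : Integrable f) (j : ℕ) :
    iteratedFDeriv ℝ j (fun z => ∫ y, heatK (z - y) * f y) =
      fun z => ∫ y, f y • iteratedFDeriv ℝ j heatK (z - y) := by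
  have hbd : ∀ i : ℕ, ∃ C : ℝ, 0 < C ∧ ∀ z : E3, ‖iteratedFDeriv ℝ i heatK z‖ ≤ C := by
    intro i
    obtain ⟨C, hC, h⟩ := norm_iteratedFDeriv_heatK_le i
    refine ⟨C, hC, fun z => (h z).trans ?_⟩
    have : (1 + ‖z‖) ^ (-4 : ℝ) ≤ 1 :=
      Real.rpow_le_one_of_one_le_of_nonpos (by linarith [norm_nonneg z]) (by norm_num)
    nlinarith
  have hcont : ∀ i : ℕ, Continuous (iteratedFDeriv ℝ i heatK) := fun i =>
    contDiff_heatK.continuous_iteratedFDeriv (by exact_mod_cast le_top)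
  have hint : ∀ (i : ℕ) (z : E3),
      Integrable fun y => f y • iteratedFDeriv ℝ i heatK (z - y) := by
    intro i z
    obtain ⟨C, -, h⟩ := hbd i
    refine Integrable.smul_bdd hf (C := C) ?_ (Eventually.of_forall fun y => h _)
    exact ((hcont i).comp (by fun_prop)).aestronglyMeasurable
  induction j with
  | zero =>
    ext z m
    rw [iteratedFDeriv_zero_apply, ContinuousMultilinearMap.integral_apply (hint 0 z)]
    simp [mul_comm]
  | succ j ih =>
    set L := (continuousMultilinearCurryLeftEquiv ℝ (fun _ : Fin (j + 1) => E3) ℝ).symm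
    have hdiff : Differentiable ℝ (iteratedFDeriv ℝ j heatK) :=
      contDiff_heatK.differentiable_iteratedFDeriv (by exact_mod_cast ENat.natCast_lt_top j)
    have hL : ∀ z, iteratedFDeriv ℝ (j + 1) heatK z = L (fderiv ℝ (iteratedFDeriv ℝ j heatK) z) :=
      fun z => by rw [iteratedFDeriv_succ_eq_comp_left]; rfl
    rw [iteratedFDeriv_succ_eq_comp_left, ih]
    ext1 z
    obtain ⟨C, hC, hCb⟩ := hbd (j + 1)
    have hder : HasFDerivAt (fun z => ∫ y, f y • iteratedFDeriv ℝ j heatK (z - y))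
        (∫ y, f y • fderiv ℝ (iteratedFDeriv ℝ j heatK) (z - y)) z := by
      refine hasFDerivAt_integral_of_dominated_of_fderiv_le (s := univ)
        (bound := fun y => ‖f y‖ * C)
        (F' := fun z y => f y • fderiv ℝ (iteratedFDeriv ℝ j heatK) (z - y)) univ_mem
        (Eventually.of_forall fun z => (hint j z).aestronglyMeasurable) (hint j z) ?_
        (Eventually.of_forall fun y x _ => ?_) (hf.norm.mul_const C)
        (Eventually.of_forall fun y x _ => ?_)
      · have hc : Continuous (fderiv ℝ (iteratedFDeriv ℝ j heatK)) :=
          (contDiff_heatK.iteratedFDeriv_right (m := 1) (i := j)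
            (by exact_mod_cast le_top)).continuous_fderiv one_ne_zero
        have hc' : Continuous fun y => fderiv ℝ (iteratedFDeriv ℝ j heatK) (z - y) :=
          hc.comp (by fun_prop)
        exact aestronglyMeasurable_smul_continuous hf.aestronglyMeasurable hc'
      · rw [norm_smul]
        gcongr
        rw [norm_fderiv_iteratedFDeriv]
        exact hCb _
      · have h3 := (hdiff (x - y)).hasFDerivAt.comp x ((hasFDerivAt_id x).sub_const y)
        exact h3.const_smul (f y)
    show L (fderiv ℝ _ z) = _
    rw [hder.fderiv]
    have h4 := ContinuousLinearEquiv.integral_comp_comm (𝕜 := ℝ) (μ := volume)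
      L.toContinuousLinearEquiv (fun y => f y • fderiv ℝ (iteratedFDeriv ℝ j heatK) (z - y))
    refine Eq.trans h4.symm (integral_congr_ae (Eventually.of_forall fun y => ?_))
    simp only [hL]
    exact map_smul L _ _

/-- The integrable radial kernel `(1 + ‖z‖) ^ (-4)`. -/
def kap {E : Type*} [Norm E] (z : E) : ℝ≥0∞ := ENNReal.ofReal ((1 + ‖z‖) ^ (-4 : ℝ))

theorem measurable_kap {E : Type*} [NormedAddCommGroup E] [MeasurableSpace E] [BorelSpace E] :
    Measurable (kap : E → ℝ≥0∞) := by
  unfold kap; fun_prop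

theorem kap_le_one {E : Type*} [NormedAddCommGroup E] (z : E) : kap z ≤ 1 := by
  rw [kap, ENNReal.ofReal_le_one]
  exact Real.rpow_le_one_of_one_le_of_nonpos (by linarith [norm_nonneg z]) (by norm_num)

theorem kap_le_kap {E F : Type*} [NormedAddCommGroup E] [NormedAddCommGroup F] {z : E} {w : F}
    (h : ‖w‖ ≤ ‖z‖) : kap z ≤ kap w := by
  refine ENNReal.ofReal_le_ofReal (Real.rpow_le_rpow_of_nonpos ?_ ?_ (by norm_num))
  · linarith [norm_nonneg w]
  · linarith

theorem kap_le_kap_coord (z : E3) (i : Fin 3) : kap z ≤ kap (z i) :=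
  kap_le_kap (PiLp.norm_apply_le z i)

theorem lintegral_kap_real_lt_top : ∫⁻ t : ℝ, kap t < ∞ :=
  finite_integral_one_add_norm (by simp)

theorem lintegral_kap_E3_lt_top : ∫⁻ z : E3, kap z < ∞ :=
  finite_integral_one_add_norm (by simp; norm_num)

/-- The convolution of `kap` with the indicator function of `A`. -/
def kapConv (A : Set E3) (x : E3) : ℝ≥0∞ := ∫⁻ y in A, kap (x - y)

theorem measurable_kapConv (A : Set E3) : Measurable (kapConv A) := by
  have h : Measurable fun z : E3 × E3 => kap (z.1 - z.2) :=
    measurable_kap.comp (measurable_fst.sub measurable_snd)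
  exact h.lintegral_prod_right'

theorem kapConv_le_lintegral (A : Set E3) (x : E3) : kapConv A x ≤ ∫⁻ z : E3, kap z :=
  (setLIntegral_le_lintegral _ _).trans_eq (lintegral_sub_left_eq_self kap x)

theorem kapConv_le_volume (A : Set E3) (x : E3) : kapConv A x ≤ volume A := by
  calc kapConv A x ≤ ∫⁻ _ in A, 1 := lintegral_mono fun y => kap_le_one _
    _ = volume A := by simp

theorem rotZ_apply_zero (θ : ℝ) (x : E3) :
    rotZ θ x 0 = x 0 * Real.cos θ - x 1 * Real.sin θ := rfl

theorem rotZ_apply_one (θ : ℝ) (x : E3) :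
    rotZ θ x 1 = x 0 * Real.sin θ + x 1 * Real.cos θ := rfl

theorem rotZ_apply_two (θ : ℝ) (x : E3) : rotZ θ x 2 = x 2 := rfl

/-- `rotZ θ` as a linear isometry. -/
def rotZIsom (θ : ℝ) : E3 →ₗᵢ[ℝ] E3 where
  toFun := rotZ θ
  map_add' x y := by
    ext i; fin_cases i <;> simp [rotZ_apply_zero, rotZ_apply_one, rotZ_apply_two] <;> ring
  map_smul' c x := by
    ext i; fin_cases i <;> simp [rotZ_apply_zero, rotZ_apply_one, rotZ_apply_two] <;> ring
  norm_map' x := by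
    show ‖rotZ θ x‖ = ‖x‖
    rw [EuclideanSpace.norm_eq, EuclideanSpace.norm_eq]
    congr 1
    simp only [Fin.sum_univ_three, rotZ_apply_zero, rotZ_apply_one, rotZ_apply_two,
      Real.norm_eq_abs, sq_abs]
    linear_combination (x 0 ^ 2 + x 1 ^ 2) * Real.sin_sq_add_cos_sq θ

theorem measurePreserving_rotZ (θ : ℝ) : MeasurePreserving (rotZ θ) :=
  ((rotZIsom θ).toLinearIsometryEquiv rfl).measurePreserving

theorem measurableEmbedding_rotZ (θ : ℝ) : MeasurableEmbedding (rotZ θ) :=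
  ((rotZIsom θ).toLinearIsometryEquiv rfl).toHomeomorph.measurableEmbedding

theorem kapConv_rotZ {A : Set E3} (hA : ∀ θ x, rotZ θ x ∈ A ↔ x ∈ A) (θ : ℝ) (x : E3) :
    kapConv A (rotZ θ x) = kapConv A x := by
  have hpre : rotZ θ ⁻¹' A = A := by ext x; exact hA θ x
  have h := (measurePreserving_rotZ θ).setLIntegral_comp_preimage_emb
    (measurableEmbedding_rotZ θ) (fun y => kap (rotZ θ x - y)) A
  rw [hpre] at h
  rw [kapConv, kapConv, ← h]
  refine lintegral_congr fun y => ?_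
  have h2 : rotZ θ x - rotZ θ y = rotZ θ (x - y) := ((rotZIsom θ).map_sub x y).symm
  have h3 : ‖rotZ θ (x - y)‖ = ‖x - y‖ := (rotZIsom θ).norm_map _
  rw [h2, kap, kap, h3]

theorem rr_nonneg (x : E3) : 0 ≤ rr x := Real.sqrt_nonneg _

theorem exists_rotZ_eq (x : E3) : ∃ φ, x = rotZ φ !₂[rr x, 0, x 2] := by
  have hr : rr x = ‖(⟨x 0, x 1⟩ : ℂ)‖ := by
    rw [rr, Complex.norm_def, Complex.normSq_mk, sq, sq]
  refine ⟨Complex.arg ⟨x 0, x 1⟩, ?_⟩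
  ext i
  fin_cases i
  · show x 0 = rr x * _ - 0 * _
    rw [hr, Complex.norm_mul_cos_arg]; simp
  · show x 1 = rr x * _ + 0 * _
    rw [hr, Complex.norm_mul_sin_arg]; simp
  · rfl

theorem mul_lintegral_kap_sin_le {r : ℝ} (hr : 0 < r) (b : ℝ) :
    ENNReal.ofReal r * ∫⁻ θ in Icc (0:ℝ) 1, kap (r * Real.sin θ - b) ≤
      2 * ∫⁻ t : ℝ, kap t := by
  have hcos : ∀ θ ∈ Icc (0:ℝ) 1, 1 / 2 ≤ Real.cos θ := by
    intro θ hθ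
    rw [← Real.cos_pi_div_three]
    refine Real.cos_le_cos_of_nonneg_of_le_pi hθ.1 ?_ ?_ <;>
      linarith [hθ.2, Real.pi_gt_three]
  have hinj : InjOn (fun θ => r * Real.sin θ) (Icc (0:ℝ) 1) := by
    intro s hs t ht hst
    refine Real.injOn_sin ⟨?_, ?_⟩ ⟨?_, ?_⟩ (mul_left_cancel₀ hr.ne' hst) <;>
      linarith [hs.1, hs.2, ht.1, ht.2, Real.pi_gt_three]
  have hsub := lintegral_image_eq_lintegral_abs_deriv_mul (s := Icc (0:ℝ) 1)
    (f := fun θ => r * Real.sin θ) (f' := fun θ => r * Real.cos θ) measurableSet_Icc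
    (fun θ _ => ((Real.hasDerivAt_sin θ).const_mul r).hasDerivWithinAt) hinj
    (fun t => kap (t - b))
  calc ENNReal.ofReal r * ∫⁻ θ in Icc (0:ℝ) 1, kap (r * Real.sin θ - b)
      = ∫⁻ θ in Icc (0:ℝ) 1, ENNReal.ofReal r * kap (r * Real.sin θ - b) := by
        rw [lintegral_const_mul' _ _ ENNReal.ofReal_ne_top]
    _ ≤ ∫⁻ θ in Icc (0:ℝ) 1,
          2 * (ENNReal.ofReal |r * Real.cos θ| * kap (r * Real.sin θ - b)) := by
        refine setLIntegral_mono' measurableSet_Icc fun θ hθ => ?_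
        rw [← mul_assoc]
        gcongr
        have h2 : (2 : ℝ≥0∞) = ENNReal.ofReal 2 := by simp
        rw [h2, ← ENNReal.ofReal_mul (by norm_num)]
        apply ENNReal.ofReal_le_ofReal
        have := hcos θ hθ
        rw [abs_of_nonneg (by positivity)]
        nlinarith
    _ = 2 * ∫⁻ t in (fun θ => r * Real.sin θ) '' Icc (0:ℝ) 1, kap (t - b) := by
        rw [lintegral_const_mul' _ _ (by simp), hsub]
    _ ≤ 2 * ∫⁻ t : ℝ, kap (t - b) := by gcongr; exact Measure.restrict_le_self
    _ = 2 * ∫⁻ t : ℝ, kap t := by rw [lintegral_sub_right_eq_self (fun t : ℝ => kap t) b]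

/-- For rotation-invariant `A`, averaging over rotations gains a factor `1 / r`. -/
theorem rr_mul_kapConv_le {A : Set E3} (hA : ∀ θ x, rotZ θ x ∈ A ↔ x ∈ A) (x : E3) :
    ENNReal.ofReal (rr x) * kapConv A x ≤ (2 * ∫⁻ t : ℝ, kap t) * volume A := by
  rcases (rr_nonneg x).eq_or_lt with h0 | hr
  · rw [← h0]; simp
  obtain ⟨φ, hφ⟩ := exists_rotZ_eq x
  set e : E3 := !₂[rr x, 0, x 2] with he
  have hrot : Continuous fun θ => rotZ θ e := by
    unfold rotZ
    simp only [WithLp.equiv_symm_apply]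
    refine (PiLp.continuous_toLp 2 _).comp (continuous_pi fun i => ?_)
    fin_cases i <;> simp <;> fun_prop
  have hx : kapConv A x = ∫⁻ θ in Icc (0:ℝ) 1, kapConv A (rotZ θ e) := by
    rw [hφ, kapConv_rotZ hA]
    simp [kapConv_rotZ hA]
  have hmeas : Measurable fun z : ℝ × E3 => kap (rotZ z.1 e - z.2) :=
    measurable_kap.comp ((hrot.measurable.comp measurable_fst).sub measurable_snd)
  have hswap : ∫⁻ θ in Icc (0:ℝ) 1, kapConv A (rotZ θ e) =
      ∫⁻ y in A, ∫⁻ θ in Icc (0:ℝ) 1, kap (rotZ θ e - y) :=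
    lintegral_lintegral_swap hmeas.aemeasurable
  rw [hx, hswap, ← lintegral_const_mul' _ _ ENNReal.ofReal_ne_top]
  calc ∫⁻ y in A, ENNReal.ofReal (rr x) * ∫⁻ θ in Icc (0:ℝ) 1, kap (rotZ θ e - y)
      ≤ ∫⁻ _ in A, 2 * ∫⁻ t : ℝ, kap t := by
        refine lintegral_mono fun y => le_trans ?_ (mul_lintegral_kap_sin_le hr (y 1))
        refine mul_le_mul' le_rfl (lintegral_mono fun θ => ?_)
        refine (kap_le_kap_coord _ 1).trans_eq ?_
        have : (rotZ θ e - y) 1 = rr x * Real.sin θ - y 1 := by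
          simp [rotZ_apply_one, he]
        rw [this]
    _ = _ := by rw [setLIntegral_const]

theorem lintegral_E3_mul (a b c : ℝ → ℝ≥0∞) (ha : Measurable a) (hb : Measurable b)
    (hc : Measurable c) :
    ∫⁻ x : E3, a (x 0) * (b (x 1) * c (x 2)) =
      (∫⁻ t, a t) * ((∫⁻ t, b t) * ∫⁻ t, c t) := by
  have h2 := volume_preserving_piFinSuccAbove (fun _ : Fin 3 => ℝ) 0
  have h3 := volume_preserving_finTwoArrow ℝ
  have e3 : ∫⁻ z : Fin 2 → ℝ, b (z 0) * c (z 1) = (∫⁻ t, b t) * ∫⁻ t, c t := by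
    rw [← lintegral_prod_mul hb.aemeasurable hc.aemeasurable]
    exact h3.lintegral_comp (f := fun z : ℝ × ℝ => b z.1 * c z.2) (by fun_prop)
  have e2 : ∫⁻ z : Fin 3 → ℝ, a (z 0) * (b (z 1) * c (z 2)) =
      (∫⁻ t, a t) * ∫⁻ z : Fin 2 → ℝ, b (z 0) * c (z 1) := by
    rw [← lintegral_prod_mul ha.aemeasurable (by fun_prop)]
    exact h2.lintegral_comp (f := fun z : ℝ × (Fin 2 → ℝ) => a z.1 * (b (z.2 0) * c (z.2 1)))
      (by fun_prop)
  rw [← e3, ← e2]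
  exact (PiLp.volume_preserving_ofLp (Fin 3)).lintegral_comp
    (f := fun z : Fin 3 → ℝ => a (z 0) * (b (z 1) * c (z 2))) (by fun_prop)

theorem rpow_mul_le_mul_rpow {c h M V : ℝ≥0∞} {θ : ℝ} (h0 : 0 ≤ θ) (h1 : θ ≤ 1) (hM : h ≤ M)
    (hV : c * h ≤ M * V) : c ^ θ * h ≤ M * V ^ θ := by
  have hsplit : ∀ t : ℝ≥0∞, t = t ^ (1 - θ) * t ^ θ := fun t => by
    rw [← ENNReal.rpow_add_of_nonneg _ _ (by linarith) h0]; simp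
  calc c ^ θ * h = h ^ (1 - θ) * (c * h) ^ θ := by
        conv_lhs => rw [hsplit h]
        rw [ENNReal.mul_rpow_of_nonneg _ _ h0]; ring
    _ ≤ M ^ (1 - θ) * (M * V) ^ θ := by
        gcongr
    _ = M * V ^ θ := by
        conv_rhs => rw [hsplit M]
        rw [ENNReal.mul_rpow_of_nonneg _ _ h0]; ring

/-- One-dimensional truncated power weight. -/
def wA (γ t : ℝ) : ℝ≥0∞ :=
  (Icc (-1 : ℝ) 1).indicator (fun t => ENNReal.ofReal |t| ^ (γ / 2)) t

theorem measurable_wA (γ : ℝ) : Measurable (wA γ) :=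
  Measurable.indicator (by fun_prop) measurableSet_Icc

theorem lintegral_wA_lt_top {γ : ℝ} (hγ : -2 < γ) : ∫⁻ t, wA γ t < ∞ := by
  set g : ℝ → ℝ≥0∞ := fun t => ENNReal.ofReal |t| ^ (γ / 2) with hg
  have hpos : ∫⁻ t in Icc (0:ℝ) 1, g t < ∞ := by
    have hint : IntegrableOn (fun t : ℝ => t ^ (γ / 2)) (Ioc 0 1) := by
      rw [← intervalIntegrable_iff_integrableOn_Ioc_of_le zero_le_one]
      exact intervalIntegral.intervalIntegrable_rpow' (by linarith)
    rw [setLIntegral_congr Ioc_ae_eq_Icc.symm]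
    refine lt_of_eq_of_lt (setLIntegral_congr_fun measurableSet_Ioc fun t ht => ?_)
      hint.setLIntegral_lt_top
    simp only [hg]
    rw [abs_of_pos ht.1, ENNReal.ofReal_rpow_of_pos ht.1]
  have hneg : ∫⁻ t in Icc (-1:ℝ) 0, g t < ∞ := by
    have h := (Measure.measurePreserving_neg (volume : Measure ℝ)).setLIntegral_comp_preimage_emb
      (Homeomorph.neg ℝ).measurableEmbedding g (Icc (-1:ℝ) 0)
    rw [← h]
    simpa [hg] using hpos
  have : ∫⁻ t, wA γ t = ∫⁻ t in Icc (-1:ℝ) 1, g t := lintegral_indicator measurableSet_Icc _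
  rw [this, ← Icc_union_Icc_eq_Icc (by norm_num : (-1:ℝ) ≤ 0) zero_le_one]
  exact (lintegral_union_le _ _ _).trans_lt (ENNReal.add_lt_top.2 ⟨hneg, hpos⟩)

theorem abs_coord_le_rr (x : E3) : |x 0| ≤ rr x ∧ |x 1| ≤ rr x := by
  constructor <;> refine Real.abs_le_sqrt ?_ <;> nlinarith [sq_nonneg (x 0), sq_nonneg (x 1)]

theorem rr_rpow_le_wA {β : ℝ} (x : E3) (hx : rr x ≤ 1) :
    ENNReal.ofReal (rr x) ^ β ≤ wA (min β 0) (x 0) * wA (min β 0) (x 1) := by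
  obtain ⟨h0, h1⟩ := abs_coord_le_rr x
  have hm : ∀ {t : ℝ}, |t| ≤ rr x → ENNReal.ofReal (rr x) ^ (min β 0 / 2) ≤ wA (min β 0) t := by
    intro t ht
    have hmem : t ∈ Icc (-1:ℝ) 1 := abs_le.1 (ht.trans hx)
    rw [wA, indicator_of_mem hmem]
    have hneg : 0 ≤ -(min β 0 / 2) := by linarith [min_le_right β 0]
    rw [← neg_neg (min β 0 / 2), ENNReal.rpow_neg, ENNReal.rpow_neg _ (-(min β 0 / 2))]
    exact ENNReal.inv_le_inv.2 (ENNReal.rpow_le_rpow (ENNReal.ofReal_le_ofReal ht) hneg)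
  calc ENNReal.ofReal (rr x) ^ β ≤ ENNReal.ofReal (rr x) ^ (min β 0) :=
        ENNReal.rpow_le_rpow_of_exponent_ge (by simpa using hx) (min_le_left _ _)
    _ = ENNReal.ofReal (rr x) ^ (min β 0 / 2) * ENNReal.ofReal (rr x) ^ (min β 0 / 2) := by
        rw [← sq, ← ENNReal.rpow_two, ← ENNReal.rpow_mul]; congr 1; ring
    _ ≤ _ := mul_le_mul' (hm h0) (hm h1)

theorem lintegral_weight_mul_kapConv_le {γ : ℝ} (hγ : -2 < γ) :
    ∃ C : ℝ≥0∞, C < ∞ ∧ ∀ A : Set E3,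
      ∫⁻ x : E3, (1 + wA γ (x 0) * wA γ (x 1)) * kapConv A x ≤ C * volume A := by
  refine ⟨(∫⁻ z : E3, kap z) + (∫⁻ t, wA γ t) * ((∫⁻ t, wA γ t) * ∫⁻ t : ℝ, kap t),
    ENNReal.add_lt_top.2 ⟨lintegral_kap_E3_lt_top, ENNReal.mul_lt_top (lintegral_wA_lt_top hγ)
      (ENNReal.mul_lt_top (lintegral_wA_lt_top hγ) lintegral_kap_real_lt_top)⟩, fun A => ?_⟩
  have hw := measurable_wA γ
  have hk : Measurable (kap : E3 → ℝ≥0∞) := measurable_kap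
  have hk1 : Measurable (kap : ℝ → ℝ≥0∞) := measurable_kap
  have hmeas : Measurable fun z : E3 × E3 =>
      (1 + wA γ (z.1 0) * wA γ (z.1 1)) * kap (z.1 - z.2) := by fun_prop
  calc ∫⁻ x : E3, (1 + wA γ (x 0) * wA γ (x 1)) * kapConv A x
      = ∫⁻ x : E3, ∫⁻ y in A, (1 + wA γ (x 0) * wA γ (x 1)) * kap (x - y) := by
        refine lintegral_congr fun x => ?_
        rw [kapConv, lintegral_const_mul _ (by fun_prop)]
    _ = ∫⁻ y in A, ∫⁻ x : E3, (1 + wA γ (x 0) * wA γ (x 1)) * kap (x - y) :=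
        lintegral_lintegral_swap hmeas.aemeasurable
    _ ≤ ∫⁻ _ in A, ((∫⁻ z : E3, kap z) +
          (∫⁻ t, wA γ t) * ((∫⁻ t, wA γ t) * ∫⁻ t : ℝ, kap t)) := by
        refine lintegral_mono fun y => ?_
        simp only [add_mul, one_mul]
        rw [lintegral_add_left (by fun_prop), lintegral_sub_right_eq_self (fun z : E3 => kap z) y,
          ← lintegral_sub_right_eq_self (fun t : ℝ => kap t) (y 2),
          ← lintegral_E3_mul _ _ (fun t => kap (t - y 2)) hw hw (by fun_prop)]
        refine add_le_add le_rfl (lintegral_mono fun x => ?_)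
        rw [mul_assoc]
        exact mul_le_mul' le_rfl (mul_le_mul' le_rfl (kap_le_kap_coord (x - y) 2))
    _ = _ := by rw [setLIntegral_const]

/-- Restricted-type weighted estimate for indicator functions of rotation-invariant sets. -/
theorem eLpNorm_weight_kapConv_le {p : ℝ≥0∞} {α a : ℝ} (hp : 1 < p) (ha1 : a ≤ 1)
    (haP : 1 / p.toReal ≤ a) (hαa : α ≤ a - 1 / p.toReal)
    (hα : (p = ∞ ∧ 0 ≤ α) ∨ (p ≠ ∞ ∧ -2 < α * p.toReal)) :
    ∃ C : ℝ≥0∞, C < ∞ ∧ ∀ A : Set E3, (∀ θ x, rotZ θ x ∈ A ↔ x ∈ A) →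
      eLpNorm (fun x => ENNReal.ofReal (rr x) ^ α * kapConv A x) p volume ≤
        C * volume A ^ a := by
  set M : ℝ≥0∞ := (∫⁻ z : E3, kap z) + (1 + 2 * ∫⁻ t : ℝ, kap t) with hM
  have hMtop : M < ∞ := ENNReal.add_lt_top.2 ⟨lintegral_kap_E3_lt_top,
    ENNReal.add_lt_top.2 ⟨by simp, ENNReal.mul_lt_top (by simp) lintegral_kap_real_lt_top⟩⟩
  have hb0 : ∀ A x, kapConv A x ≤ M := fun A x => (kapConv_le_lintegral A x).trans le_self_add
  have hb1 : ∀ A x, 1 * kapConv A x ≤ M * volume A := fun A x => by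
    rw [one_mul]
    calc kapConv A x ≤ 1 * volume A := by rw [one_mul]; exact kapConv_le_volume A x
      _ ≤ M * volume A := by gcongr; exact le_add_left le_self_add
  have hb2 : ∀ A : Set E3, (∀ θ x, rotZ θ x ∈ A ↔ x ∈ A) → ∀ x,
      ENNReal.ofReal (rr x) * kapConv A x ≤ M * volume A := fun A hA x =>
    (rr_mul_kapConv_le hA x).trans (by gcongr; exact le_add_left le_add_self)
  rcases hα with ⟨rfl, hα0⟩ | ⟨hpt, hαp⟩
  · refine ⟨M, hMtop, fun A hA => ?_⟩
    simp only [ENNReal.toReal_top, div_zero, sub_zero] at haP hαa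
    rw [eLpNorm_exponent_top]
    refine essSup_le_of_ae_le _ (Eventually.of_forall fun x => ?_)
    simp only [enorm_eq_self]
    rcases le_total (rr x) 1 with hr | hr
    · calc ENNReal.ofReal (rr x) ^ α * kapConv A x ≤ 1 ^ a * kapConv A x := by
            gcongr
            rw [ENNReal.one_rpow]
            exact ENNReal.rpow_le_one (by simpa using hr) hα0
        _ ≤ M * volume A ^ a := rpow_mul_le_mul_rpow haP ha1 (hb0 A x) (hb1 A x)
    · calc ENNReal.ofReal (rr x) ^ α * kapConv A x ≤ ENNReal.ofReal (rr x) ^ a * kapConv A x := by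
            gcongr
            simpa using hr
        _ ≤ M * volume A ^ a := rpow_mul_le_mul_rpow haP ha1 (hb0 A x) (hb2 A hA x)
  · set P := p.toReal with hPdef
    have hP : 1 < P := by
      have := (ENNReal.toReal_lt_toReal (by simp) hpt).2 hp
      simpa using this
    have hP0 : 0 < P := by linarith
    have hPa : 1 ≤ P * a := by rwa [div_le_iff₀ hP0, mul_comm] at haP
    have hβ : α * P ≤ P * a - 1 := by
      calc α * P ≤ (a - 1 / P) * P := by gcongr
        _ = P * a - 1 := by field_simp
    set θ := (P * a - 1) / (P - 1) with hθ
    have hθ0 : 0 ≤ θ := div_nonneg (by linarith) (by linarith)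
    have hθ1 : θ ≤ 1 := by rw [hθ, div_le_one (by linarith)]; nlinarith
    have hθP : θ * (P - 1) = P * a - 1 := div_mul_cancel₀ _ (by linarith)
    obtain ⟨C, hC, hCA⟩ := lintegral_weight_mul_kapConv_le (γ := min (α * P) 0)
      (lt_min hαp (by norm_num))
    refine ⟨(M ^ (P - 1) * C) ^ (1 / P), ENNReal.rpow_lt_top_of_nonneg (by positivity)
      (ENNReal.mul_lt_top (ENNReal.rpow_lt_top_of_nonneg (by linarith) hMtop.ne) hC).ne,
      fun A hA => ?_⟩
    have hpt1 : ∀ x : E3, (ENNReal.ofReal (rr x) ^ α * kapConv A x) ^ P ≤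
        (M * volume A ^ θ) ^ (P - 1) *
          ((1 + wA (min (α * P) 0) (x 0) * wA (min (α * P) 0) (x 1)) * kapConv A x) := by
      intro x
      have hsplit : (ENNReal.ofReal (rr x) ^ α * kapConv A x) ^ P =
          (ENNReal.ofReal (rr x) ^ (α * P) * kapConv A x ^ (P - 1)) * kapConv A x := by
        rw [ENNReal.mul_rpow_of_nonneg _ _ hP0.le, ← ENNReal.rpow_mul, mul_assoc]
        congr 1
        conv_rhs => rw [← ENNReal.rpow_one (kapConv A x), ← ENNReal.rpow_mul]
        rw [← ENNReal.rpow_add_of_nonneg _ _ (by linarith) zero_le_one]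
        congr 1; ring
      rw [hsplit, ← mul_assoc]
      refine mul_le_mul' ?_ le_rfl
      rcases le_total (rr x) 1 with hr | hr
      · rw [mul_comm]
        refine mul_le_mul' ?_ ((rr_rpow_le_wA x hr).trans le_add_self)
        refine ENNReal.rpow_le_rpow ?_ (by linarith)
        have := rpow_mul_le_mul_rpow hθ0 hθ1 (hb0 A x) (hb1 A x)
        rwa [ENNReal.one_rpow, one_mul] at this
      · calc ENNReal.ofReal (rr x) ^ (α * P) * kapConv A x ^ (P - 1)
            ≤ ENNReal.ofReal (rr x) ^ (θ * (P - 1)) * kapConv A x ^ (P - 1) := by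
              rw [hθP]
              exact mul_le_mul' (ENNReal.rpow_le_rpow_of_exponent_le (by simpa using hr) hβ) le_rfl
          _ = (ENNReal.ofReal (rr x) ^ θ * kapConv A x) ^ (P - 1) := by
              rw [ENNReal.mul_rpow_of_nonneg _ _ (by linarith), ← ENNReal.rpow_mul]
          _ ≤ (M * volume A ^ θ) ^ (P - 1) :=
              ENNReal.rpow_le_rpow
                (rpow_mul_le_mul_rpow hθ0 hθ1 (hb0 A x) (hb2 A hA x)) (by linarith)
          _ ≤ _ := le_mul_of_one_le_right' le_self_add
    rw [eLpNorm_eq_lintegral_rpow_enorm_toReal (by positivity) hpt]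
    simp only [enorm_eq_self, ← hPdef]
    have hmeas : Measurable fun x : E3 =>
        (1 + wA (min (α * P) 0) (x 0) * wA (min (α * P) 0) (x 1)) * kapConv A x := by
      have := measurable_wA (min (α * P) 0)
      have := measurable_kapConv A
      fun_prop
    calc (∫⁻ x, (ENNReal.ofReal (rr x) ^ α * kapConv A x) ^ P) ^ (1 / P)
        ≤ ((M * volume A ^ θ) ^ (P - 1) * (C * volume A)) ^ (1 / P) := by
          refine ENNReal.rpow_le_rpow ((lintegral_mono hpt1).trans ?_) (by positivity)
          rw [lintegral_const_mul _ hmeas]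
          exact mul_le_mul' le_rfl (hCA A)
      _ = (M ^ (P - 1) * C) ^ (1 / P) * volume A ^ a := by
          have h1 : (M * volume A ^ θ) ^ (P - 1) * (C * volume A) =
              (M ^ (P - 1) * C) * volume A ^ (P * a) := by
            rw [ENNReal.mul_rpow_of_nonneg _ _ (by linarith), ← ENNReal.rpow_mul, hθP]
            have h2 : volume A ^ (P * a) = volume A ^ (P * a - 1) * volume A := by
              conv_rhs => rw [← ENNReal.rpow_one (volume A), ← ENNReal.rpow_mul]
              rw [← ENNReal.rpow_add_of_nonneg _ _ (by linarith) zero_le_one]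
              congr 1; ring
            rw [h2]; ring
          rw [h1, ENNReal.mul_rpow_of_nonneg _ _ (by positivity), ← ENNReal.rpow_mul]
          congr 2
          field_simp

theorem eLpNorm_tsum_le {X ι : Type*} [MeasurableSpace X] {μ : Measure X} [Countable ι]
    {g : ι → X → ℝ≥0∞} (hg : ∀ i, Measurable (g i)) {p : ℝ≥0∞} (hp : 1 ≤ p) :
    eLpNorm (fun x => ∑' i, g i x) p μ ≤ ∑' i, eLpNorm (g i) p μ := by
  have hfin : ∀ s : Finset ι, eLpNorm (fun x => ∑ i ∈ s, g i x) p μ ≤ ∑' i, eLpNorm (g i) p μ := by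
    intro s
    have h := eLpNorm_sum_le (s := s) (f := g) (μ := μ)
      (fun i _ => (hg i).aestronglyMeasurable) hp
    rw [Finset.sum_fn] at h
    exact h.trans (ENNReal.sum_le_tsum s)
  rcases eq_or_ne p ∞ with rfl | hpt
  · simp only [eLpNorm_exponent_top] at hfin ⊢
    refine essSup_le_of_ae_le _ ?_
    have h : ∀ᵐ x ∂μ, ∀ s : Finset ι, ∑ i ∈ s, g i x ≤ ∑' i, eLpNormEssSup (g i) μ := by
      refine ae_all_iff.2 fun s => ?_
      filter_upwards [ENNReal.ae_le_essSup (μ := μ) fun x => ‖∑ i ∈ s, g i x‖ₑ] with x hx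
      exact hx.trans (hfin s)
    filter_upwards [h] with x hx
    rw [enorm_eq_self, ENNReal.tsum_eq_iSup_sum]
    exact iSup_le hx
  · have hp0 : p ≠ 0 := (zero_lt_one.trans_le hp).ne'
    have hP : 0 < p.toReal := ENNReal.toReal_pos hp0 hpt
    simp only [eLpNorm_eq_lintegral_rpow_enorm_toReal hp0 hpt, enorm_eq_self] at hfin ⊢
    have h1 : ∀ x, (∑' i, g i x) ^ p.toReal = ⨆ s : Finset ι, (∑ i ∈ s, g i x) ^ p.toReal := by
      intro x
      rw [ENNReal.tsum_eq_iSup_sum]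
      exact (ENNReal.orderIsoRpow p.toReal hP).map_iSup _
    simp only [h1]
    rw [lintegral_iSup_directed]
    · rw [one_div, ENNReal.rpow_inv_le_iff hP]
      refine iSup_le fun s => ?_
      rw [← ENNReal.rpow_inv_le_iff hP, ← one_div]
      exact hfin s
    · exact fun s => ((Finset.measurable_fun_sum s fun i _ => hg i).pow_const _).aemeasurable
    · intro s t
      classical
      refine ⟨s ∪ t, fun x => ?_, fun x => ?_⟩
      · exact ENNReal.rpow_le_rpow (Finset.sum_le_sum_of_subset Finset.subset_union_left) hP.le
      · exact ENNReal.rpow_le_rpow (Finset.sum_le_sum_of_subset Finset.subset_union_right) hP.le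

theorem tsum_ofReal_pow_natAbs_lt_top {r : ℝ} (h0 : 0 ≤ r) (h1 : r < 1) :
    ∑' k : ℤ, ENNReal.ofReal (r ^ k.natAbs) < ∞ := by
  refine Summable.tsum_ofReal_lt_top (summable_int_iff_summable_nat_and_neg.2 ⟨?_, ?_⟩)
  · simpa using summable_geometric_of_lt_one h0 h1
  · simpa using summable_geometric_of_lt_one h0 h1

theorem volume_superlevel_le {F : Type*} [NormedAddCommGroup F] {f : E3 → F} {q L l : ℝ}
    (hq : 0 < q) (hL : 0 < L) (hf : wnorm' f q ≤ ENNReal.ofReal L) (hl : 0 < l) :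
    volume {y | L * l ≤ ‖f y‖} ≤ ENNReal.ofReal (l ^ (-q)) := by
  have h : ENNReal.ofReal (L * l) * volume {y | L * l ≤ ‖f y‖} ^ (1 / q) ≤ ENNReal.ofReal L :=
    (le_iSup₂ (f := fun (l : ℝ) (_ : 0 < l) =>
      ENNReal.ofReal l * (volume {x : E3 | l ≤ ‖f x‖}) ^ (1 / q)) (L * l) (by positivity)).trans hf
  have h2 : volume {y | L * l ≤ ‖f y‖} ^ (1 / q) ≤ ENNReal.ofReal l⁻¹ := by
    have := ENNReal.le_div_iff_mul_le (a := volume {y | L * l ≤ ‖f y‖} ^ (1 / q))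
      (b := ENNReal.ofReal (L * l)) (c := ENNReal.ofReal L)
      (Or.inl (by simpa using by positivity)) (Or.inl ENNReal.ofReal_ne_top)
    refine (this.2 (by rwa [mul_comm])).trans_eq ?_
    rw [← ENNReal.ofReal_div_of_pos (by positivity)]
    congr 1
    field_simp
  rw [one_div, ENNReal.rpow_inv_le_iff hq] at h2
  refine h2.trans_eq ?_
  rw [ENNReal.ofReal_rpow_of_pos (by positivity), Real.inv_rpow hl.le, Real.rpow_neg hl.le]

theorem enorm_le_tsum_dyadic {F : Type*} [NormedAddCommGroup F] (f : E3 → F) {L : ℝ} (hL : 0 < L)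
    (y : E3) : ‖f y‖ₑ ≤ ∑' k : ℤ, ENNReal.ofReal (L * 2 ^ (k + 1)) *
      {y | L * 2 ^ k ≤ ‖f y‖}.indicator 1 y := by
  rcases eq_or_ne (f y) 0 with h0 | h0
  · simp [h0]
  · have hpos : 0 < ‖f y‖ / L := div_pos (norm_pos_iff.2 h0) hL
    obtain ⟨k, hk1, hk2⟩ := exists_mem_Ico_zpow hpos (one_lt_two (α := ℝ))
    refine le_trans ?_ (ENNReal.le_tsum k)
    rw [le_div_iff₀' hL] at hk1
    rw [div_lt_iff₀' hL] at hk2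
    rw [Set.indicator_of_mem (by exact hk1), Pi.one_apply, mul_one, ← ofReal_norm]
    exact ENNReal.ofReal_le_ofReal hk2.le

theorem enorm_rpow_le_ofReal_rpow {r : ℝ} (hr : 0 ≤ r) (α : ℝ) :
    ‖r ^ α‖ₑ ≤ ENNReal.ofReal r ^ α := by
  rw [Real.enorm_of_nonneg (by positivity)]
  rcases hr.eq_or_lt with rfl | hr
  · rcases lt_trichotomy α 0 with h | rfl | h
    · simp [ENNReal.zero_rpow_of_neg h]
    · simp
    · simp [Real.zero_rpow h.ne']
  · rw [ENNReal.ofReal_rpow_of_pos hr]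

theorem lintegral_kap_mul_enorm_le {f : E3 → ℝ} (hf : Measurable f) {L : ℝ} (hL : 0 < L) (x : E3) :
    ∫⁻ y, kap (x - y) * ‖f y‖ₑ ≤
      ∑' k : ℤ, ENNReal.ofReal (L * 2 ^ (k + 1)) * kapConv {y | L * 2 ^ k ≤ ‖f y‖} x := by
  have hE : ∀ k : ℤ, MeasurableSet {y | L * 2 ^ k ≤ ‖f y‖} := fun k =>
    measurableSet_le measurable_const hf.norm
  have hk : Measurable fun y => kap (x - y) :=
    measurable_kap.comp (measurable_const.sub measurable_id)
  calc ∫⁻ y, kap (x - y) * ‖f y‖ₑ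
      ≤ ∫⁻ y, ∑' k : ℤ, ENNReal.ofReal (L * 2 ^ (k + 1)) *
          {y | L * 2 ^ k ≤ ‖f y‖}.indicator (fun y => kap (x - y)) y := by
        refine lintegral_mono fun y => ?_
        refine (mul_le_mul_right (enorm_le_tsum_dyadic f hL y) _).trans_eq ?_
        rw [← ENNReal.tsum_mul_left]
        refine tsum_congr fun k => ?_
        by_cases h : y ∈ {y | L * 2 ^ k ≤ ‖f y‖}
        · rw [Set.indicator_of_mem h, Set.indicator_of_mem h, Pi.one_apply, mul_one, mul_comm]
        · simp only [Set.indicator_of_notMem h, mul_zero]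
    _ = _ := by
        rw [lintegral_tsum fun k => ((hk.indicator (hE k)).const_mul _).aemeasurable]
        refine tsum_congr fun k => ?_
        rw [lintegral_const_mul _ (hk.indicator (hE k)), lintegral_indicator (hE k), kapConv]

theorem two_zpow_mul_rpow_le {q a δ : ℝ} {k : ℤ} (h : (k : ℝ) * (1 - q * a) ≤ -δ * k.natAbs) :
    (2:ℝ) ^ (k + 1) * (((2:ℝ) ^ k) ^ (-q)) ^ a ≤ 2 * ((2:ℝ) ^ (-δ)) ^ k.natAbs := by
  have h2 : (0:ℝ) < 2 := two_pos
  rw [zpow_add_one₀ h2.ne', ← Real.rpow_intCast, ← Real.rpow_natCast, ← Real.rpow_mul h2.le,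
    ← Real.rpow_mul h2.le, ← Real.rpow_mul h2.le, mul_right_comm, ← Real.rpow_add h2, mul_comm]
  gcongr
  · exact one_le_two
  · linarith

theorem ofReal_two_zpow_mul_le {q a δ : ℝ} {k : ℤ} {C V N : ℝ≥0∞} (ha : 0 ≤ a)
    (hV : V ≤ ENNReal.ofReal (((2:ℝ) ^ k) ^ (-q))) (hN : N ≤ C * V ^ a)
    (h : (k : ℝ) * (1 - q * a) ≤ -δ * k.natAbs) :
    ENNReal.ofReal (2 ^ (k + 1)) * N ≤ C * 2 * ENNReal.ofReal (((2:ℝ) ^ (-δ)) ^ k.natAbs) := by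
  have h2 : (0:ℝ) < 2 := two_pos
  calc ENNReal.ofReal (2 ^ (k + 1)) * N
      ≤ ENNReal.ofReal (2 ^ (k + 1)) * (C * ENNReal.ofReal (((2:ℝ) ^ k) ^ (-q)) ^ a) := by
        gcongr
        exact hN.trans (by gcongr)
    _ = C * ENNReal.ofReal (2 ^ (k + 1) * (((2:ℝ) ^ k) ^ (-q)) ^ a) := by
        rw [ENNReal.ofReal_rpow_of_pos (by positivity), ENNReal.ofReal_mul (by positivity)]
        ring
    _ ≤ C * ENNReal.ofReal (2 * ((2:ℝ) ^ (-δ)) ^ k.natAbs) := by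
        exact mul_le_mul_right (ENNReal.ofReal_le_ofReal (two_zpow_mul_rpow_le h)) _
    _ = _ := by
        rw [ENNReal.ofReal_mul two_pos.le, mul_assoc]
        simp

theorem norm_iteratedFDeriv_heat_le (j : ℕ) : ∃ C : ℝ, 0 < C ∧ ∀ f : E3 → ℝ, Integrable f → ∀ x,
    ‖iteratedFDeriv ℝ j (fun z => ∫ y, heatK (z - y) * f y) x‖ₑ ≤
      ENNReal.ofReal C * ∫⁻ y, kap (x - y) * ‖f y‖ₑ := by
  obtain ⟨C, hC, h⟩ := norm_iteratedFDeriv_heatK_le j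
  refine ⟨C, hC, fun f hf x => ?_⟩
  rw [iteratedFDeriv_convolution_heatK f hf j,
    ← lintegral_const_mul' _ _ ENNReal.ofReal_ne_top]
  refine (enorm_integral_le_lintegral_enorm _).trans (lintegral_mono fun y => ?_)
  rw [enorm_smul, mul_comm, ← mul_assoc, kap, ← ENNReal.ofReal_mul hC.le]
  gcongr
  rw [← ofReal_norm]
  exact ENNReal.ofReal_le_ofReal (h _)

theorem exists_forall_wnorm_le_eLpNorm_le {q : ℝ} {p : ℝ≥0∞} (j : ℕ) {α : ℝ} (hq : 1 < q)
    (hqp : ENNReal.ofReal q < p)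
    (hα : (-2 / p.toReal < α ∧ α < 1 / q - 1 / p.toReal) ∨ (p = ⊤ ∧ α = 0)) :
    ∃ K : ℝ≥0∞, K < ∞ ∧ ∀ f : E3 → ℝ, Measurable f → Integrable f →
      (∀ θ x, f (rotZ θ x) = f x) → ∀ L : ℝ, 0 < L → wnorm' f q ≤ ENNReal.ofReal L →
        eLpNorm (fun x => rr x ^ α • iteratedFDeriv ℝ j (fun z => ∫ y, heatK (z - y) * f y) x)
          p volume ≤ K * ENNReal.ofReal L := by
  have hq0 : 0 < q := zero_lt_one.trans hq
  have hp1 : 1 < p := lt_of_le_of_lt (by simpa using hq.le) hqp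
  have hP0 : 0 ≤ 1 / p.toReal := by positivity
  have hPq : 1 / p.toReal < 1 / q := by
    rcases eq_or_ne p ∞ with rfl | hpt
    · simpa using hq0
    · exact one_div_lt_one_div_of_lt hq0 ((ENNReal.ofReal_lt_iff_lt_toReal hq0.le hpt).1 hqp)
  have hαq : α + 1 / p.toReal < 1 / q := by
    rcases hα with h | ⟨rfl, rfl⟩
    · linarith [h.2]
    · simpa using hq0
  have hα' : (p = ∞ ∧ 0 ≤ α) ∨ (p ≠ ∞ ∧ -2 < α * p.toReal) := by
    rcases eq_or_ne p ∞ with rfl | hpt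
    · refine Or.inl ⟨rfl, ?_⟩
      rcases hα with h | h
      · simpa using h.1.le
      · exact h.2.ge
    · refine Or.inr ⟨hpt, ?_⟩
      rcases hα with h | h
      · exact (div_lt_iff₀ (ENNReal.toReal_pos (zero_lt_one.trans hp1).ne' hpt)).1 h.1
      · exact absurd h.1 hpt
  have hq1 : 1 / q < 1 := (div_lt_one hq0).2 hq
  obtain ⟨a₁, h1q, h11⟩ := exists_between hq1
  obtain ⟨a₂, hm2, h2q⟩ := exists_between (max_lt hPq hαq)
  obtain ⟨hP2, hα2⟩ := max_lt_iff.1 hm2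
  have hqa1 : 1 < q * a₁ := by rwa [div_lt_iff₀' hq0] at h1q
  have hqa2 : q * a₂ < 1 := by rwa [lt_div_iff₀' hq0] at h2q
  obtain ⟨C₁, hC₁, hN₁⟩ := eLpNorm_weight_kapConv_le (α := α) (a := a₁) hp1 h11.le
    (by linarith) (by linarith) hα'
  obtain ⟨C₂, hC₂, hN₂⟩ := eLpNorm_weight_kapConv_le (α := α) (a := a₂) hp1
    (by linarith) hP2.le (by linarith) hα'
  obtain ⟨C, hC, hD⟩ := norm_iteratedFDeriv_heat_le j
  obtain ⟨δ, hδ0, hδ⟩ := exists_between (lt_min (sub_pos.2 hqa1) (sub_pos.2 hqa2))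
  obtain ⟨hδ1, hδ2⟩ := lt_min_iff.1 hδ
  set S := ∑' k : ℤ, ENNReal.ofReal (((2:ℝ) ^ (-δ)) ^ k.natAbs)
  have hS : S < ∞ := tsum_ofReal_pow_natAbs_lt_top (by positivity)
    (Real.rpow_lt_one_of_one_lt_of_neg one_lt_two (neg_lt_zero.2 hδ0))
  refine ⟨ENNReal.ofReal C * ((C₁ + C₂) * 2 * S), ?_, fun f hfm hfi hax L hL hw => ?_⟩
  · finiteness
  set E : ℤ → Set E3 := fun k => {y | L * 2 ^ k ≤ ‖f y‖}
  have hE : ∀ k θ x, rotZ θ x ∈ E k ↔ x ∈ E k := fun k θ x => by simp only [E, mem_ofPred_eq, hax]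
  have hV : ∀ k, volume (E k) ≤ ENNReal.ofReal (((2:ℝ) ^ k) ^ (-q)) := fun k =>
    volume_superlevel_le hq0 hL hw (by positivity)
  set g : ℤ → E3 → ℝ≥0∞ := fun k x => ENNReal.ofReal (rr x) ^ α * kapConv (E k) x
  have hrr : Measurable rr := by unfold rr; fun_prop
  have hg : ∀ k, Measurable (g k) := fun k =>
    (hrr.ennreal_ofReal.pow_const _).mul (measurable_kapConv _)
  have hterm : ∀ k, ENNReal.ofReal (2 ^ (k + 1)) * eLpNorm (g k) p volume ≤
      (C₁ + C₂) * 2 * ENNReal.ofReal (((2:ℝ) ^ (-δ)) ^ k.natAbs) := by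
    intro k
    rcases le_total 0 k with hk | hk
    · have hk' : (0:ℝ) ≤ k := by exact_mod_cast hk
      refine (ofReal_two_zpow_mul_le (by linarith) (hV k) (hN₁ _ (hE k)) (δ := δ) ?_).trans ?_
      · rw [Nat.cast_natAbs, abs_of_nonneg hk]
        nlinarith
      · gcongr
        exact le_self_add
    · have hk' : (k:ℝ) ≤ 0 := by exact_mod_cast hk
      refine (ofReal_two_zpow_mul_le (by linarith) (hV k) (hN₂ _ (hE k)) (δ := δ) ?_).trans ?_
      · rw [Nat.cast_natAbs, abs_of_nonpos hk]
        push_cast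
        nlinarith
      · gcongr
        exact le_add_self
  have hpt : ∀ x,
      ‖rr x ^ α • iteratedFDeriv ℝ j (fun z => ∫ y, heatK (z - y) * f y) x‖ₑ ≤
        ENNReal.ofReal C * ‖∑' k : ℤ, ENNReal.ofReal (L * 2 ^ (k + 1)) * g k x‖ₑ := by
    intro x
    rw [enorm_smul, enorm_eq_self]
    calc _ ≤ ENNReal.ofReal (rr x) ^ α * (ENNReal.ofReal C *
          ∑' k : ℤ, ENNReal.ofReal (L * 2 ^ (k + 1)) * kapConv (E k) x) := by
          gcongr
          · exact enorm_rpow_le_ofReal_rpow (rr_nonneg x) α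
          · refine (hD f hfi x).trans ?_
            gcongr
            exact lintegral_kap_mul_enorm_le hfm hL x
      _ = _ := by
          rw [mul_left_comm, ← ENNReal.tsum_mul_left]
          simp only [g, mul_left_comm]
  have hmeas : ∀ k : ℤ, Measurable fun x => ENNReal.ofReal (L * 2 ^ (k + 1)) * g k x := fun k =>
    (hg k).const_mul _
  calc _ ≤ ENNReal.ofReal C *
        eLpNorm (fun x => ∑' k : ℤ, ENNReal.ofReal (L * 2 ^ (k + 1)) * g k x) p volume :=
        eLpNorm_le_mul_eLpNorm_of_ae_le_mul'' p
          (Measurable.tsum hmeas).aestronglyMeasurable (.of_forall hpt)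
    _ ≤ ENNReal.ofReal C * ∑' k : ℤ, ENNReal.ofReal (L * 2 ^ (k + 1)) *
          eLpNorm (g k) p volume := by
        gcongr
        refine (eLpNorm_tsum_le hmeas hp1.le).trans (ENNReal.tsum_le_tsum fun k => ?_)
        exact eLpNorm_le_mul_eLpNorm_of_ae_le_mul'' p (hg k).aestronglyMeasurable
          (.of_forall fun x => le_rfl)
    _ ≤ ENNReal.ofReal C * ∑' k : ℤ, ENNReal.ofReal L *
          ((C₁ + C₂) * 2 * ENNReal.ofReal (((2:ℝ) ^ (-δ)) ^ k.natAbs)) := by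
        refine mul_le_mul_right (ENNReal.tsum_le_tsum fun k => ?_) _
        rw [ENNReal.ofReal_mul hL.le, mul_assoc]
        exact mul_le_mul_right (hterm k) _
    _ = _ := by
        rw [ENNReal.tsum_mul_left, ENNReal.tsum_mul_left]
        ring

/-- Weighted heat kernel estimate for axisymmetric functions. -/
theorem stmt6 (q : ℝ) (p : ℝ≥0∞) (j : ℕ) (α : ℝ) (hq : 1 < q) (hqp : ENNReal.ofReal q < p)
    (hα : (-2 / p.toReal < α ∧ α < 1 / q - 1 / p.toReal) ∨ (p = ⊤ ∧ α = 0)) :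
    ∃ C : ℝ, 0 < C ∧
      ∀ f : SchwartzMap E3 ℝ, (∀ θ x, f (rotZ θ x) = f x) →
        eLpNorm (fun x => rr x ^ α •
            iteratedFDeriv ℝ j
              (fun z => ∫ y : E3, (4 * π) ^ (-(3:ℝ)/2) * Real.exp (-‖z - y‖^2 / 4) * f y) x)
          p volume ≤ ENNReal.ofReal C * wnorm' (⇑f) q := by
  obtain ⟨K, hK, h⟩ := exists_forall_wnorm_le_eLpNorm_le j hq hqp hα
  have hC : 0 < K.toReal + 1 := by positivity
  refine ⟨K.toReal + 1, hC, fun f hax => ?_⟩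
  have hKC : K ≤ ENNReal.ofReal (K.toReal + 1) :=
    (ENNReal.ofReal_toReal hK.ne).ge.trans (ENNReal.ofReal_le_ofReal (by linarith))
  by_contra! hlt
  rw [mul_comm, ← ENNReal.lt_div_iff_mul_lt (Or.inl (ENNReal.ofReal_pos.2 hC).ne')
    (Or.inl ENNReal.ofReal_ne_top)] at hlt
  obtain ⟨L, hL1, hL2⟩ := ENNReal.lt_iff_exists_nnreal_btwn.1 hlt
  have hL0 : 0 < (L : ℝ) := by exact_mod_cast zero_le.trans_lt hL1
  have h1 := h f f.continuous.measurable f.integrable hax L hL0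
    (by rw [ENNReal.ofReal_coe_nnreal]; exact hL1.le)
  rw [ENNReal.ofReal_coe_nnreal] at h1
  rw [ENNReal.lt_div_iff_mul_lt (Or.inl (ENNReal.ofReal_pos.2 hC).ne')
    (Or.inl ENNReal.ofReal_ne_top), mul_comm] at hL2
  exact absurd (h1.trans (by gcongr)) hL2.not_ge
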